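/- (1) For non-negative integers a, m, in Ṽ_θ(0): ⟨−1⟩^{(a)}⟨−1,1⟩^{[m]}φ̃ = Σ_{s=0}^{⌊a/2⌋} (∏_{ν=1}^{s} [2m+2ν]/[2ν]) q^{−2(a−s)m + (a−2s)(a−2s−1)/2} ⟨1⟩^{(a−2s)}⟨−1,1⟩^{[m+s]}φ̃. (2) For a positive odd integer k > 1 and non-negative integers n, a, in Ṽ_θ(0): ⟨−k⟩^{(n)}⟨−k+2,k−2⟩^{[a]}φ̃ = Σ_{u=0}^{n} Σ_{i+j+2t=n, j+t=u} q^{2ai + j(j−1)/2 − i(t+u)} ⟨k⟩^{(i)}⟨−k+2,k⟩^{(j)}⟨−k,k⟩^{[t]}⟨−k+2,k−2⟩^{[a−u]}φ̃. (3) For odd integers ℓ > k and non-negative integers n, a, in U_q^-(gl_∞): ⟨k⟩^{(n)}⟨k+2,ℓ⟩^{(a)} = Σ_{s=0}^{n} q^{(n−s)(a−s)} ⟨k+2,ℓ⟩^{(a−s)}⟨k,ℓ⟩^{(s)}⟨k⟩^{(n−s)}. -/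

import Mathlib

/-! Basic setup: `K = ℚ(q)` and the algebra `U_q^-(gl_∞)`. -/

noncomputable section

/-- The base field `K = ℚ(q)`. -/
abbrev K : Type := RatFunc ℚ

/-- The indeterminate `q`. -/
def q : K := RatFunc.X

/-- The `q`-integer `[n]`. -/
def qint (n : ℤ) : K := (q ^ n - q ^ (-n)) / (q - q⁻¹)

/-- The `q`-factorial `[n]!`. -/
def qfact (n : ℕ) : K := ∏ k ∈ Finset.range n, qint (k + 1)

/-- The `q`-Serre relations defining `U_q^-(gl_∞)`; the generator indexed by `a : ℤ`
corresponds to `f_i` for the odd integer `i = 2a+1`, so that `|i - j| > 2 ↔ 1 < |a - b|`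
and `|i - j| = 2 ↔ |a - b| = 1`. -/
inductive URel : FreeAlgebra K ℤ → FreeAlgebra K ℤ → Prop
  | far (a b : ℤ) (h : 1 < |a - b|) :
      URel (FreeAlgebra.ι K a * FreeAlgebra.ι K b) (FreeAlgebra.ι K b * FreeAlgebra.ι K a)
  | serre (a b : ℤ) (h : |a - b| = 1) :
      URel (FreeAlgebra.ι K a * FreeAlgebra.ι K a * FreeAlgebra.ι K b
            + FreeAlgebra.ι K b * (FreeAlgebra.ι K a * FreeAlgebra.ι K a))
           ((q + q⁻¹) • (FreeAlgebra.ι K a * FreeAlgebra.ι K b * FreeAlgebra.ι K a))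

/-- The algebra `U_q^-(gl_∞)`. -/
abbrev U : Type := RingQuot URel

/-- The generator `f_i` of `U_q^-(gl_∞)`, for an odd integer `i`. -/
def fgen (i : ℤ) : U := RingQuot.mkAlgHom K URel (FreeAlgebra.ι K ((i - 1) / 2))

/-- `segAux i n` is the segment `⟨i, i+2n⟩`. -/
def segAux (i : ℤ) : ℕ → U
  | 0 => fgen i
  | n + 1 => segAux i n * fgen (i + 2 * (n + 1)) - q • (fgen (i + 2 * (n + 1)) * segAux i n)

/-- The segment `⟨i,j⟩ ∈ U_q^-(gl_∞)` for odd `i ≤ j`. -/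
def seg (i j : ℤ) : U := segAux i ((j - i) / 2).toNat

/-- The divided power `⟨i,j⟩^{(n)}` (zero for `n < 0`). -/
def segPow (i j : ℤ) (n : ℤ) : U :=
  if n < 0 then 0 else (qfact n.toNat)⁻¹ • seg i j ^ n.toNat

/-- The modified divided power `⟨i,j⟩^{[n]}`. -/
def segPowM (i j : ℤ) (n : ℤ) : U :=
  if i = -j then
    (if n < 0 then 0 else (∏ ν ∈ Finset.range n.toNat, qint (2 * (ν + 1)))⁻¹ • seg i j ^ n.toNat)
  else segPow i j n


/-- The left ideal `Σ_k U_q^-(gl_∞)(f_k − f_{−k})` (over odd `k`). -/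
def Jideal : Ideal U := Ideal.span {x : U | ∃ k : ℤ, Odd k ∧ x = fgen k - fgen (-k)}

/-- The quotient module `Ṽ_θ(0)`. -/
abbrev Vt : Type := U ⧸ Jideal

/-- The generator `φ̃ ∈ Ṽ_θ(0)`, image of `1`. -/
def phi : Vt := Submodule.Quotient.mk 1

/-! ### Quantum integers -/

lemma q_ne_zero : q ≠ 0 := RatFunc.X_ne_zero

lemma q_zpow_ne_one {n : ℤ} (hn : 0 < n) : q ^ n ≠ 1 := by
  obtain ⟨m, rfl⟩ := Int.eq_ofNat_of_zero_le hn.le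
  intro h
  rw [zpow_natCast, q, ← RatFunc.algebraMap_X, ← map_pow,
    ← map_one (algebraMap (Polynomial ℚ) (RatFunc ℚ))] at h
  have h' := congrArg Polynomial.natDegree (RatFunc.algebraMap_injective ℚ h)
  rw [Polynomial.natDegree_X_pow, Polynomial.natDegree_one] at h'
  omega

lemma q_zpow_sub_ne_zero {n : ℤ} (hn : 0 < n) : q ^ n - q ^ (-n) ≠ 0 := by
  intro h
  apply q_zpow_ne_one (n := n + n) (by omega)
  rw [zpow_add₀ q_ne_zero]
  nth_rewrite 1 [sub_eq_zero.mp h]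
  rw [← zpow_add₀ q_ne_zero, neg_add_cancel, zpow_zero]

lemma q_sub_inv_ne_zero : q - q⁻¹ ≠ 0 := by
  simpa using q_zpow_sub_ne_zero one_pos

lemma one_add_q_sq_ne_zero : 1 + q ^ 2 ≠ 0 := by
  intro h
  apply q_zpow_ne_one (n := 4) (by norm_num)
  have h2 : q ^ 2 = -1 := by linear_combination h
  calc q ^ (4 : ℤ) = (q ^ 2) ^ 2 := by rw [← pow_mul]; norm_cast
    _ = 1 := by rw [h2]; norm_num

lemma qint_ne_zero {n : ℤ} (hn : 0 < n) : qint n ≠ 0 :=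
  div_ne_zero (q_zpow_sub_ne_zero hn) q_sub_inv_ne_zero

@[simp] lemma qint_zero : qint 0 = 0 := by simp [qint]

@[simp] lemma qint_one : qint 1 = 1 := by
  simpa [qint] using div_self q_sub_inv_ne_zero

lemma qint_add (x y : ℤ) : qint (x + y) = q ^ (-y) * qint x + q ^ x * qint y := by
  simp only [qint, neg_add, zpow_add₀ q_ne_zero]
  ring

lemma zpow_mul_qint_add {e e₁ e₂ x y : ℤ} (h₁ : e₁ = e - y) (h₂ : e₂ = e + x) :
    q ^ e * qint (x + y) = q ^ e₁ * qint x + q ^ e₂ * qint y := by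
  rw [qint_add, h₁, h₂, sub_eq_add_neg, zpow_add₀ q_ne_zero, zpow_add₀ q_ne_zero]
  ring

lemma triangular_succ (d : ℤ) : (d + 1) * d / 2 = d * (d - 1) / 2 + d := by
  rw [show (d + 1) * d = d * (d - 1) + d * 2 by ring, Int.add_mul_ediv_right _ _ two_ne_zero]

lemma sum_range_shift {M : Type*} [AddCommMonoid M] (f : ℕ → M) (N : ℕ)
    (h₀ : f 0 = 0) (hN : f N = 0) :
    ∑ s ∈ Finset.range N, f (s + 1) = ∑ s ∈ Finset.range N, f s := by
  have h := Finset.sum_range_succ' f N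
  rw [Finset.sum_range_succ, h₀, hN, add_zero, add_zero] at h
  exact h.symm

/-! ### Divided powers normalised by a sequence of scalars -/

section DividedPowers

variable {R : Type*} [Ring R] [Algebra K R]

/-- The divided power `xⁿ / (c 1 ⋯ c n)`, zero for `n < 0`. -/
def dpow (c : ℤ → K) (x : R) (n : ℤ) : R :=
  if n < 0 then 0 else (∏ k ∈ Finset.range n.toNat, c (k + 1))⁻¹ • x ^ n.toNat

lemma dpow_of_neg (c : ℤ → K) (x : R) {n : ℤ} (hn : n < 0) : dpow c x n = 0 := if_pos hn

lemma dpow_natCast (c : ℤ → K) (x : R) (n : ℕ) :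
    dpow c x n = (∏ k ∈ Finset.range n, c (k + 1))⁻¹ • x ^ n := by
  simp [dpow]

@[simp] lemma dpow_zero (c : ℤ → K) (x : R) : dpow c x 0 = 1 := by simp [dpow]

lemma mul_dpow {c : ℤ → K} (h₀ : c 0 = 0) (hc : ∀ n > 0, c n ≠ 0) (x : R) (n : ℤ) :
    x * dpow c x n = c (n + 1) • dpow c x (n + 1) := by
  rcases lt_or_ge n 0 with hn | hn
  · rw [dpow_of_neg c x hn, mul_zero]
    rcases eq_or_lt_of_le (show n + 1 ≤ 0 by omega) with h | h
    · rw [h, h₀, zero_smul]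
    · rw [dpow_of_neg c x h, smul_zero]
  · obtain ⟨m, rfl⟩ := Int.eq_ofNat_of_zero_le hn
    have h := hc (m + 1) (by omega)
    have h' := dpow_natCast c x (m + 1)
    push_cast at h'
    rw [h', dpow_natCast, Finset.prod_range_succ, mul_inv, mul_comm _ (c (m + 1))⁻¹,
      smul_smul, ← mul_assoc, mul_inv_cancel₀ h, one_mul, pow_succ', mul_smul_comm]

lemma mul_pow_of_smul_comm {x y : R} {r : K} (h : y * x = r • (x * y)) (n : ℕ) :
    y * x ^ n = r ^ n • (x ^ n * y) := by
  induction n with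
  | zero => simp
  | succ n ih =>
    rw [pow_succ, ← mul_assoc, ih, smul_mul_assoc, mul_assoc, h, mul_smul_comm, smul_smul,
      ← pow_succ, mul_assoc]

lemma pow_mul_of_smul_comm {x y : R} {r : K} (h : x * y = r • (y * x)) (n : ℕ) :
    x ^ n * y = r ^ n • (y * x ^ n) := by
  induction n with
  | zero => simp
  | succ n ih =>
    rw [pow_succ', mul_assoc, ih, mul_smul_comm, ← mul_assoc, h, smul_mul_assoc, smul_smul,
      ← pow_succ, mul_assoc]

lemma mul_dpow_of_smul_comm (c : ℤ → K) {x y : R} {r : K} (h : y * x = r • (x * y)) (n : ℤ) :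
    y * dpow c x n = r ^ n • (dpow c x n * y) := by
  rcases lt_or_ge n 0 with hn | hn
  · simp [dpow_of_neg c x hn]
  · obtain ⟨m, rfl⟩ := Int.eq_ofNat_of_zero_le hn
    rw [dpow_natCast, mul_smul_comm, mul_pow_of_smul_comm h, smul_mul_assoc, smul_comm,
      zpow_natCast]

lemma dpow_mul_of_smul_comm (c : ℤ → K) {x y : R} {r : K} (h : x * y = r • (y * x)) (n : ℤ) :
    dpow c x n * y = r ^ n • (y * dpow c x n) := by
  rcases lt_or_ge n 0 with hn | hn
  · simp [dpow_of_neg c x hn]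
  · obtain ⟨m, rfl⟩ := Int.eq_ofNat_of_zero_le hn
    rw [dpow_natCast, smul_mul_assoc, pow_mul_of_smul_comm h, mul_smul_comm, smul_comm,
      zpow_natCast]

lemma mul_dpow_qint (x : R) (n : ℤ) :
    x * dpow qint x n = qint (n + 1) • dpow qint x (n + 1) :=
  mul_dpow qint_zero (fun _ => qint_ne_zero) x n

/-- The normalisation `ν ↦ [2ν]` of the modified divided powers. -/
def qintDouble (n : ℤ) : K := qint (2 * n)

lemma qintDouble_ne_zero {n : ℤ} (hn : 0 < n) : qintDouble n ≠ 0 :=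
  qint_ne_zero (by omega)

lemma mul_dpow_qintDouble (x : R) (n : ℤ) :
    x * dpow qintDouble x n = qintDouble (n + 1) • dpow qintDouble x (n + 1) :=
  mul_dpow (by simp [qintDouble]) (fun _ => qintDouble_ne_zero) x n

lemma mul_pow_succ_of_qcomm {x y z : R} (hxy : x * y = q • (y * x) + z)
    (hzy : z * y = q⁻¹ • (y * z)) (n : ℕ) :
    x * y ^ (n + 1) = q ^ (n + 1) • (y ^ (n + 1) * x) + qint (n + 1) • (y ^ n * z) := by
  induction n with
  | zero => simp [hxy]
  | succ n ih =>
    have hq : qint (((n + 1 : ℕ) : ℤ) + 1) = q ^ (n + 1) + qint (n + 1) * q⁻¹ := by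
      push_cast
      rw [qint_add, qint_one, zpow_neg_one, mul_one, mul_comm, add_comm]
      norm_cast
    rw [pow_succ, ← mul_assoc, ih, hq, add_mul, smul_mul_assoc, smul_mul_assoc, mul_assoc, hxy,
      mul_assoc, hzy, mul_add, smul_add, mul_smul_comm, mul_smul_comm, smul_smul, smul_smul,
      ← pow_succ, ← mul_assoc, ← mul_assoc, ← pow_succ, ← pow_succ, add_smul, add_assoc]

lemma pow_succ_mul_of_qcomm {x y z : R} (hxy : x * y = q • (y * x) + z)
    (hxz : x * z = q⁻¹ • (z * x)) (n : ℕ) :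
    x ^ (n + 1) * y = q ^ (n + 1) • (y * x ^ (n + 1)) + qint (n + 1) • (z * x ^ n) := by
  induction n with
  | zero => simp [hxy]
  | succ n ih =>
    have hq : qint (((n + 1 : ℕ) : ℤ) + 1) = q ^ (n + 1) + qint (n + 1) * q⁻¹ := by
      push_cast
      rw [qint_add, qint_one, zpow_neg_one, mul_one, mul_comm, add_comm]
      norm_cast
    rw [pow_succ', mul_assoc, ih, hq, mul_add, mul_smul_comm, mul_smul_comm, ← mul_assoc, hxy,
      ← mul_assoc, hxz, add_mul, smul_add, smul_mul_assoc, smul_mul_assoc, smul_smul, smul_smul,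
      ← pow_succ, mul_assoc, mul_assoc, ← pow_succ', ← pow_succ', add_smul, add_assoc]

lemma mul_dpow_of_qcomm {x y z : R} (hxy : x * y = q • (y * x) + z)
    (hzy : z * y = q⁻¹ • (y * z)) (n : ℤ) :
    x * dpow qint y n = q ^ n • (dpow qint y n * x) + dpow qint y (n - 1) * z := by
  rcases lt_trichotomy n 0 with hn | rfl | hn
  · simp [dpow_of_neg qint y hn, dpow_of_neg qint y (show n - 1 < 0 by omega)]
  · simp [dpow_of_neg qint y (show (-1 : ℤ) < 0 by omega)]
  · obtain ⟨m, rfl⟩ : ∃ m : ℕ, n = (m + 1 : ℕ) := ⟨(n - 1).toNat, by omega⟩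
    have hm : qint (m + 1) ≠ 0 := qint_ne_zero (by omega)
    rw [show ((m + 1 : ℕ) : ℤ) - 1 = m by push_cast; ring, dpow_natCast, dpow_natCast,
      mul_smul_comm, mul_pow_succ_of_qcomm hxy hzy, smul_add, smul_comm _ (q ^ (m + 1)),
      ← smul_mul_assoc, smul_smul, Finset.prod_range_succ, mul_inv, mul_assoc,
      inv_mul_cancel₀ hm, mul_one, zpow_natCast, smul_mul_assoc, smul_mul_assoc]

theorem dpow_mul_dpow_of_qcomm {x y z : R} (hxy : x * y = q • (y * x) + z)
    (hxz : x * z = q⁻¹ • (z * x)) (hzy : z * y = q⁻¹ • (y * z)) (a : ℤ) (N n : ℕ) (hn : n < N) :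
    dpow qint x n * dpow qint y a = ∑ s ∈ Finset.range N,
      q ^ (((n : ℤ) - s) * (a - s)) •
        (dpow qint y (a - s) * dpow qint z s * dpow qint x ((n : ℤ) - s)) := by
  induction n with
  | zero =>
    rw [Finset.sum_eq_single_of_mem 0 (Finset.mem_range.mpr hn)]
    · simp
    · intro s _ hs
      rw [dpow_of_neg qint x (by omega), mul_zero, smul_zero]
  | succ n ih =>
    have hne : qint ((n : ℤ) + 1) ≠ 0 := qint_ne_zero (by omega)
    apply smul_right_injective R hne
    have hstep (s : ℕ) :
        x * (q ^ (((n : ℤ) - s) * (a - s)) •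
          (dpow qint y (a - s) * dpow qint z s * dpow qint x ((n : ℤ) - s))) =
        (q ^ (((n : ℤ) - s) * (a - s) + (a - s) - s) * qint ((n : ℤ) - s + 1)) •
          (dpow qint y (a - s) * dpow qint z s * dpow qint x ((n : ℤ) + 1 - s)) +
        (q ^ (((n : ℤ) + 1 - (s + 1 : ℕ)) * (a + 1 - (s + 1 : ℕ))) * qint (s + 1 : ℕ)) •
          (dpow qint y (a - (s + 1 : ℕ)) * dpow qint z (s + 1 : ℕ) *
            dpow qint x ((n : ℤ) + 1 - (s + 1 : ℕ))) := by
      have e₁ := mul_dpow_of_qcomm hxy hzy (a - s)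
      have e₂ := mul_dpow_of_smul_comm qint hxz s
      have e₃ := mul_dpow_qint x ((n : ℤ) - s)
      have e₄ := mul_dpow_qint z s
      rw [mul_smul_comm, mul_assoc, ← mul_assoc x, e₁, add_mul, smul_mul_assoc,
        mul_assoc _ x, ← mul_assoc x, e₂, smul_mul_assoc, mul_assoc _ x, e₃, mul_assoc _ z,
        ← mul_assoc z, e₄]
      simp only [mul_smul_comm, smul_mul_assoc, smul_smul, smul_add, mul_assoc]
      push_cast
      rw [show (n : ℤ) + 1 - (s + 1) = n - s by ring, show a + 1 - ((s : ℤ) + 1) = a - s by ring,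
        show a - ((s : ℤ) + 1) = a - s - 1 by ring, show (n : ℤ) + 1 - s = n - s + 1 by ring]
      congr 2
      rw [zpow_sub₀ q_ne_zero (_ + _), zpow_add₀ q_ne_zero, inv_zpow]
      ring
    have hlhs : qint ((n : ℤ) + 1) • (dpow qint x (n + 1 : ℕ) * dpow qint y a) =
        x * (dpow qint x n * dpow qint y a) := by
      rw [← mul_assoc, mul_dpow_qint, smul_mul_assoc]
      push_cast
      rfl
    beta_reduce
    have hshift := sum_range_shift (fun s : ℕ =>
      (q ^ (((n : ℤ) + 1 - s) * (a + 1 - s)) * qint s) •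
        (dpow qint y (a - s) * dpow qint z s * dpow qint x ((n : ℤ) + 1 - s))) N (by simp)
      (by rw [dpow_of_neg qint x (by omega), mul_zero, smul_zero])
    rw [hlhs, ih (by omega), Finset.mul_sum, Finset.sum_congr rfl fun s _ => hstep s,
      Finset.sum_add_distrib, hshift, ← Finset.sum_add_distrib, Finset.smul_sum]
    refine Finset.sum_congr rfl fun s _ => ?_
    rw [← add_smul, smul_smul]
    push_cast
    congr 1
    have e := zpow_mul_qint_add (e := ((n : ℤ) + 1 - s) * (a - s)) (x := n - s + 1) (y := s)
      (e₁ := ((n : ℤ) - s) * (a - s) + (a - s) - s) (e₂ := ((n : ℤ) + 1 - s) * (a + 1 - s))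
      (by ring) (by ring)
    rw [← e, mul_comm]
    congr 2
    ring

lemma dpow_mul_self (c : ℤ → K) (x : R) (n : ℤ) : dpow c x n * x = x * dpow c x n := by
  simpa using dpow_mul_of_smul_comm c (x := x) (y := x) (r := 1) (one_smul K _).symm n

variable {M : Type*} [AddCommGroup M] [Module R M] [Module K M] [IsScalarTower K R M]

lemma smul_dpow_mul_dpow_smul {x y z : R} (hxy : x * y = q • (y * x) + z)
    (hxz : x * z = q⁻¹ • (z * x)) (hzy : z * y = q⁻¹ • (y * z)) {v : M} (hv : x • v = y • v)
    (b p : ℤ) :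
    x • ((dpow qint y b * dpow qintDouble z p) • v) =
      (q ^ (b - 2 * p) * qint (b + 1)) • ((dpow qint y (b + 1) * dpow qintDouble z p) • v) +
      qint (2 * (p + 1)) • ((dpow qint y (b - 1) * dpow qintDouble z (p + 1)) • v) := by
  have e₁ := mul_dpow_of_qcomm hxy hzy b
  have e₂ := mul_dpow_of_smul_comm qintDouble hxz p
  have e₃ := dpow_mul_of_smul_comm qintDouble hzy p
  have e₄ := mul_dpow_qint y b
  have e₅ := mul_dpow_qintDouble z p
  have e₆ : (x * dpow qintDouble z p) • v = (q ^ (-(2 * p))) • ((y * dpow qintDouble z p) • v) := by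
    rw [e₂, smul_assoc, mul_smul, hv, ← mul_smul, e₃, smul_assoc, smul_smul, inv_zpow,
      ← zpow_neg, ← zpow_add₀ q_ne_zero]
    congr 2
    ring
  rw [← mul_smul, ← mul_assoc, e₁, add_mul, add_smul, smul_mul_assoc, mul_assoc, smul_assoc,
    mul_smul, e₆, smul_comm _ (q ^ (-(2 * p))), ← mul_smul (dpow qint y b), ← mul_assoc,
    dpow_mul_self, e₄, mul_assoc, e₅, smul_mul_assoc, mul_smul_comm, smul_assoc, smul_assoc,
    smul_smul, smul_smul, sub_eq_add_neg b (2 * p), zpow_add₀ q_ne_zero]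
  rfl

theorem dpow_mul_dpow_smul {x y z : R} (hxy : x * y = q • (y * x) + z)
    (hxz : x * z = q⁻¹ • (z * x)) (hzy : z * y = q⁻¹ • (y * z)) {v : M} (hv : x • v = y • v)
    (m N n : ℕ) (hn : n < N) :
    (dpow qint x n * dpow qintDouble z m) • v = ∑ s ∈ Finset.range N,
      ((∏ ν ∈ Finset.range s, qint (2 * m + 2 * (ν + 1)) / qint (2 * (ν + 1))) *
        q ^ (-2 * ((n : ℤ) - s) * m + ((n : ℤ) - 2 * s) * ((n : ℤ) - 2 * s - 1) / 2)) •
      ((dpow qint y ((n : ℤ) - 2 * s) * dpow qintDouble z ((m : ℤ) + s)) • v) := by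
  induction n with
  | zero =>
    rw [Finset.sum_eq_single_of_mem 0 (Finset.mem_range.mpr hn)]
    · simp
    · intro s _ hs
      rw [dpow_of_neg qint y (by omega), zero_mul, zero_smul, smul_zero]
  | succ n ih =>
    have hne : qint ((n : ℤ) + 1) ≠ 0 := qint_ne_zero (by omega)
    apply smul_right_injective M hne
    set P : ℕ → K := fun s =>
      ∏ ν ∈ Finset.range s, qint (2 * m + 2 * (ν + 1)) / qint (2 * (ν + 1)) with hP
    have hPs (s : ℕ) : P s * qint (2 * (m + s + 1)) = P (s + 1) * qint (2 * (s + 1)) := by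
      have h := qint_ne_zero (show 0 < 2 * ((s : ℤ) + 1) by omega)
      rw [hP]
      beta_reduce
      rw [Finset.prod_range_succ, mul_assoc, div_mul_cancel₀ _ h]
      congr 2
      ring
    have hstep (s : ℕ) :
        x • ((P s * q ^ (-2 * ((n : ℤ) - s) * m +
            ((n : ℤ) - 2 * s) * ((n : ℤ) - 2 * s - 1) / 2)) •
          ((dpow qint y ((n : ℤ) - 2 * s) * dpow qintDouble z ((m : ℤ) + s)) • v)) =
        (P s * q ^ (-2 * ((n : ℤ) - s) * m +
            ((n : ℤ) - 2 * s) * ((n : ℤ) - 2 * s - 1) / 2 + (n - 2 * s - 2 * (m + s))) *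
              qint ((n : ℤ) + 1 - 2 * s)) •
          ((dpow qint y ((n : ℤ) + 1 - 2 * s) * dpow qintDouble z ((m : ℤ) + s)) • v) +
        (P (s + 1) * q ^ (-2 * ((n : ℤ) + 1 - (s + 1 : ℕ)) * m +
            ((n : ℤ) + 2 - 2 * (s + 1 : ℕ)) * ((n : ℤ) + 1 - 2 * (s + 1 : ℕ)) / 2) *
              qint (2 * (s + 1 : ℕ))) •
          ((dpow qint y ((n : ℤ) + 1 - 2 * (s + 1 : ℕ)) *
            dpow qintDouble z ((m : ℤ) + (s + 1 : ℕ))) • v) := by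
      rw [smul_comm x, smul_dpow_mul_dpow_smul hxy hxz hzy hv, smul_add, smul_smul, smul_smul]
      push_cast
      rw [mul_right_comm (P s) _ (qint (2 * ((m : ℤ) + s + 1))), hPs,
        show (n : ℤ) + 1 - 2 * s = n - 2 * s + 1 by ring,
        show (n : ℤ) + 1 - 2 * (s + 1) = n - 2 * s - 1 by ring,
        show (n : ℤ) + 2 - 2 * (s + 1) = n - 2 * s by ring,
        show (n : ℤ) + 1 - (s + 1) = n - s by ring, ← add_assoc (m : ℤ)]
      congr 2
      · rw [zpow_add₀ q_ne_zero (_ + _)]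
        ring
      · ring
    have hlhs : qint ((n : ℤ) + 1) • ((dpow qint x (n + 1 : ℕ) * dpow qintDouble z m) • v) =
        x • ((dpow qint x n * dpow qintDouble z m) • v) := by
      rw [← mul_smul, ← mul_assoc, mul_dpow_qint, smul_mul_assoc, smul_assoc]
      push_cast
      rfl
    have hshift := sum_range_shift (fun s : ℕ =>
      (P s * q ^ (-2 * ((n : ℤ) + 1 - s) * m +
          ((n : ℤ) + 2 - 2 * s) * ((n : ℤ) + 1 - 2 * s) / 2) * qint (2 * s)) •
        ((dpow qint y ((n : ℤ) + 1 - 2 * s) * dpow qintDouble z ((m : ℤ) + s)) • v)) N (by simp)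
      (by rw [dpow_of_neg qint y (by omega), zero_mul, zero_smul, smul_zero])
    beta_reduce
    rw [hlhs, ih (by omega), Finset.smul_sum, Finset.sum_congr rfl fun s _ => hstep s,
      Finset.sum_add_distrib, hshift, ← Finset.sum_add_distrib, Finset.smul_sum]
    refine Finset.sum_congr rfl fun s _ => ?_
    rw [← add_smul, smul_smul]
    push_cast
    congr 1
    have t₁ := triangular_succ ((n : ℤ) - 2 * s)
    have t₂ := triangular_succ ((n : ℤ) + 1 - 2 * s)
    rw [show (n : ℤ) - 2 * s + 1 = n + 1 - 2 * s by ring] at t₁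
    rw [show (n : ℤ) + 1 - 2 * s + 1 = n + 2 - 2 * s by ring,
      show (n : ℤ) + 1 - 2 * s - 1 = n - 2 * s by ring] at t₂
    have e := zpow_mul_qint_add
      (e := -2 * ((n : ℤ) + 1 - s) * m + (n + 1 - 2 * s) * (n - 2 * s) / 2)
      (x := (n : ℤ) + 1 - 2 * s) (y := 2 * s)
      (e₁ := -2 * ((n : ℤ) - s) * m +
        ((n : ℤ) - 2 * s) * ((n : ℤ) - 2 * s - 1) / 2 + (n - 2 * s - 2 * (m + s)))
      (e₂ := -2 * ((n : ℤ) + 1 - s) * m + ((n : ℤ) + 2 - 2 * s) * ((n : ℤ) + 1 - 2 * s) / 2)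
      (by rw [t₁]; ring) (by rw [t₂]; ring)
    rw [sub_add_cancel] at e
    rw [show (n : ℤ) + 1 - 2 * s - 1 = n - 2 * s by ring]
    linear_combination -P s * e

lemma smul_dpow_qintDouble_smul {x y a w c : R} (hxw : x * w = q • (w * x) + c)
    (hcw : c * w = q⁻¹ • (w * c)) (hwy : w * y = q • (y * w) + a) (hwa : w * a = q⁻¹ • (a * w))
    {v : M} (hv : x • v = y • v) (hc : q • (c • v) = a • v) (b : ℤ) :
    (x * dpow qintDouble w b) • v =
      q ^ (2 * b) • ((y * dpow qintDouble w b) • v) + (a * dpow qintDouble w (b - 1)) • v := by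
  rcases lt_trichotomy b 0 with hb | rfl | hb
  · simp [dpow_of_neg qintDouble w hb, dpow_of_neg qintDouble w (show b - 1 < 0 by omega)]
  · simp [dpow_of_neg qintDouble w (show (-1 : ℤ) < 0 by omega), hv]
  · obtain ⟨m, rfl⟩ : ∃ m : ℕ, b = (m + 1 : ℕ) := ⟨(b - 1).toNat, by omega⟩
    have hm : qintDouble (m + 1) ≠ 0 := qintDouble_ne_zero (by omega)
    have hc' : c • v = q⁻¹ • (a • v) := by rw [← hc, inv_smul_smul₀ q_ne_zero]
    have hpow : (x * w ^ (m + 1)) • v = (q ^ (2 * ((m : ℤ) + 1))) • ((y * w ^ (m + 1)) • v) +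
        qintDouble (m + 1) • ((a * w ^ m) • v) := by
      have hs : qintDouble (m + 1) =
          q ^ (m + 1) * qint (m + 1) + qint (m + 1) * (q⁻¹ * q⁻¹ ^ m) := by
        rw [qintDouble, two_mul, qint_add, zpow_neg, ← pow_succ', inv_pow]
        norm_cast
        ring
      rw [mul_pow_succ_of_qcomm hxw hcw, add_smul, smul_assoc, smul_assoc, mul_smul, mul_smul, hv,
        hc', ← mul_smul, pow_succ_mul_of_qcomm hwy hwa, smul_comm (w ^ m), ← mul_smul (w ^ m),
        pow_mul_of_smul_comm hwa, hs]
      simp only [add_smul, smul_add, smul_assoc, smul_smul]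
      rw [add_assoc, two_mul, zpow_add₀ q_ne_zero]
      norm_cast
    rw [show ((m + 1 : ℕ) : ℤ) - 1 = m by push_cast; ring, dpow_natCast, dpow_natCast,
      mul_smul_comm, mul_smul_comm, mul_smul_comm, smul_assoc, smul_assoc, smul_assoc, hpow,
      smul_add, smul_smul _ (qintDouble _), Finset.prod_range_succ, mul_inv, mul_assoc,
      inv_mul_cancel₀ hm, mul_one]
    push_cast
    rw [smul_comm (q ^ (2 * ((m : ℤ) + 1))) (_ : K)]

/-- The commutation relations between the segments `x = ⟨-k⟩`, `y = ⟨k⟩`, `a = ⟨-k+2,k⟩`,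
`b = ⟨-k,k⟩` and `w = ⟨-k+2,k-2⟩`, and the action of `x` and of `c = ⟨-k,k-2⟩` on `v`. -/
structure SymmetricRelations (x y a b w c : R) (v : M) : Prop where
  xy : x * y = y * x
  xa : x * a = q • (a * x) + b
  xb : x * b = q⁻¹ • (b * x)
  ba : b * a = q⁻¹ • (a * b)
  bY : b * y = q⁻¹ • (y * b)
  ay : a * y = q⁻¹ • (y * a)
  xw : x * w = q • (w * x) + c
  cw : c * w = q⁻¹ • (w * c)
  wy : w * y = q • (y * w) + a
  wa : w * a = q⁻¹ • (a * w)
  xv : x • v = y • v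
  cv : q • (c • v) = a • v

namespace SymmetricRelations

variable {x y a b w c : R} {v : M}

lemma smul_monomial_smul (H : SymmetricRelations x y a b w c v) (i j t d : ℤ) :
    x • ((dpow qint y i * dpow qint a j * dpow qintDouble b t * dpow qintDouble w d) • v) =
      (q ^ (2 * d - 2 * t) * qint (i + 1)) • ((dpow qint y (i + 1) * dpow qint a j *
        dpow qintDouble b t * dpow qintDouble w d) • v) +
      (q ^ (j - 2 * t) * qint (j + 1)) • ((dpow qint y i * dpow qint a (j + 1) *
        dpow qintDouble b t * dpow qintDouble w (d - 1)) • v) +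
      qint (2 * (t + 1)) • ((dpow qint y i * dpow qint a (j - 1) *
        dpow qintDouble b (t + 1) * dpow qintDouble w d) • v) := by
  have e₁ : x * dpow qint y i = dpow qint y i * x := by
    simpa using mul_dpow_of_smul_comm qint (x := y) (y := x) (r := 1) (by rw [one_smul, H.xy]) i
  have e₂ := mul_dpow_of_qcomm H.xa H.ba j
  have e₃ := mul_dpow_of_smul_comm qintDouble H.xb t
  have e₄ := smul_dpow_qintDouble_smul H.xw H.cw H.wy H.wa H.xv H.cv d
  have e₅ := dpow_mul_of_smul_comm qintDouble H.bY t
  have e₆ := dpow_mul_of_smul_comm qintDouble H.ba t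
  have e₇ := dpow_mul_of_smul_comm qint H.ay j
  have e₈ := mul_dpow_qint y i
  have e₉ := mul_dpow_qint a j
  have e₁₀ := mul_dpow_qintDouble b t
  have s₁ : x * (dpow qint y i * dpow qint a j * dpow qintDouble b t * dpow qintDouble w d) =
      (q ^ j * q⁻¹ ^ t) • (dpow qint y i * dpow qint a j * dpow qintDouble b t *
        (x * dpow qintDouble w d)) +
      qint (2 * (t + 1)) • (dpow qint y i * dpow qint a (j - 1) *
        dpow qintDouble b (t + 1) * dpow qintDouble w d) := by
    calc _ = dpow qint y i * (x * dpow qint a j) * dpow qintDouble b t * dpow qintDouble w d := by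
          simp only [← mul_assoc, e₁]
      _ = q ^ j • (dpow qint y i * dpow qint a j * (x * dpow qintDouble b t) *
            dpow qintDouble w d) + dpow qint y i * dpow qint a (j - 1) *
            (b * dpow qintDouble b t) * dpow qintDouble w d := by
          rw [e₂]
          simp only [mul_add, add_mul, mul_smul_comm, smul_mul_assoc, mul_assoc]
      _ = _ := by
          rw [e₃, e₁₀]
          simp only [mul_smul_comm, smul_mul_assoc, mul_assoc, smul_smul, qintDouble]
  have s₂ : dpow qint y i * dpow qint a j * dpow qintDouble b t * (y * dpow qintDouble w d) =
      (q⁻¹ ^ t * q⁻¹ ^ j * qint (i + 1)) • (dpow qint y (i + 1) * dpow qint a j *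
        dpow qintDouble b t * dpow qintDouble w d) := by
    calc _ = dpow qint y i * dpow qint a j * (dpow qintDouble b t * y) * dpow qintDouble w d := by
          simp only [mul_assoc]
      _ = q⁻¹ ^ t • (dpow qint y i * (dpow qint a j * y) * dpow qintDouble b t *
            dpow qintDouble w d) := by
          rw [e₅]
          simp only [mul_smul_comm, smul_mul_assoc, mul_assoc]
      _ = (q⁻¹ ^ t * q⁻¹ ^ j) • (dpow qint y i * y * dpow qint a j * dpow qintDouble b t *
            dpow qintDouble w d) := by
          rw [e₇]
          simp only [mul_smul_comm, smul_mul_assoc, mul_assoc, smul_smul]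
      _ = _ := by
          rw [dpow_mul_self, e₈]
          simp only [smul_mul_assoc, smul_smul]
  have s₃ : dpow qint y i * dpow qint a j * dpow qintDouble b t *
        (a * dpow qintDouble w (d - 1)) =
      (q⁻¹ ^ t * qint (j + 1)) • (dpow qint y i * dpow qint a (j + 1) *
        dpow qintDouble b t * dpow qintDouble w (d - 1)) := by
    calc _ = dpow qint y i * dpow qint a j * (dpow qintDouble b t * a) *
            dpow qintDouble w (d - 1) := by
          simp only [mul_assoc]
      _ = q⁻¹ ^ t • (dpow qint y i * (dpow qint a j * a) * dpow qintDouble b t *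
            dpow qintDouble w (d - 1)) := by
          rw [e₆]
          simp only [mul_smul_comm, smul_mul_assoc, mul_assoc]
      _ = _ := by
          rw [dpow_mul_self, e₉]
          simp only [mul_smul_comm, smul_mul_assoc, smul_smul]
  rw [← mul_smul, s₁, add_smul, smul_assoc, smul_assoc,
    mul_smul (dpow qint y i * dpow qint a j * dpow qintDouble b t), e₄, smul_add,
    smul_comm _ (q ^ (2 * d)), ← mul_smul, s₂, ← mul_smul, s₃, smul_add, smul_assoc, smul_assoc,
    smul_smul, smul_smul, smul_smul, inv_zpow, inv_zpow, zpow_sub₀ q_ne_zero,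
    zpow_sub₀ q_ne_zero, two_mul t, zpow_add₀ q_ne_zero t t]
  have hj : q ^ j ≠ 0 := zpow_ne_zero _ q_ne_zero
  have ht : q ^ t ≠ 0 := zpow_ne_zero _ q_ne_zero
  congr 3
  · field_simp
  · field_simp

theorem dpow_mul_dpow_smul (H : SymmetricRelations x y a b w c v) (d : ℤ) (N n : ℕ) (hn : n < N) :
    (dpow qint x n * dpow qintDouble w d) • v =
      ∑ u ∈ Finset.range N, ∑ t ∈ Finset.range N,
        q ^ (2 * d * ((n : ℤ) - u - t) + ((u : ℤ) - t) * (((u : ℤ) - t) - 1) / 2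
            - ((n : ℤ) - u - t) * ((t : ℤ) + u)) •
          ((dpow qint y ((n : ℤ) - u - t) * dpow qint a ((u : ℤ) - t) *
            dpow qintDouble b t * dpow qintDouble w (d - u)) • v) := by
  induction n with
  | zero =>
    rw [Finset.sum_eq_single_of_mem 0 (Finset.mem_range.mpr hn),
      Finset.sum_eq_single_of_mem 0 (Finset.mem_range.mpr hn)]
    · simp
    · intro t _ ht
      rw [dpow_of_neg qint y (by omega)]
      simp
    · intro u _ hu
      refine Finset.sum_eq_zero fun t _ => ?_
      rw [dpow_of_neg qint y (by omega)]
      simp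
  | succ n ih =>
    have hne : qint ((n : ℤ) + 1) ≠ 0 := qint_ne_zero (by omega)
    apply smul_right_injective M hne
    set T : ℕ → ℕ → M := fun u t =>
      (dpow qint y ((n : ℤ) + 1 - u - t) * dpow qint a ((u : ℤ) - t) *
        dpow qintDouble b t * dpow qintDouble w (d - u)) • v with hT
    have hT0 (u t : ℕ) (h : n + 1 < u + t) : T u t = 0 := by
      rw [hT]
      beta_reduce
      rw [dpow_of_neg qint y (by omega)]
      simp
    set F : ℕ → ℕ → M := fun u t => q ^ (2 * d * ((n : ℤ) - u - t) +
      ((u : ℤ) - t) * (((u : ℤ) - t) - 1) / 2 - ((n : ℤ) - u - t) * ((t : ℤ) + u)) •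
          ((dpow qint y ((n : ℤ) - u - t) * dpow qint a ((u : ℤ) - t) *
            dpow qintDouble b t * dpow qintDouble w (d - u)) • v) with hF
    set e : ℕ → ℕ → ℤ := fun u t => 2 * d * ((n : ℤ) + 1 - u - t) +
      ((u : ℤ) - t) * (((u : ℤ) - t) - 1) / 2 - ((n : ℤ) + 1 - u - t) * ((t : ℤ) + u) with he
    set A : ℕ → ℕ → M := fun u t =>
      (q ^ (e u t - u - t) * qint ((n : ℤ) + 1 - u - t)) • T u t with hA
    set B : ℕ → ℕ → M := fun u t =>
      (q ^ (e u t + (n + 1 - u - t) - 2 * t) * qint ((u : ℤ) - t)) • T u t with hB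
    set C : ℕ → ℕ → M := fun u t =>
      (q ^ (e u t + (n + 1 - 2 * t)) * qint (2 * t)) • T u t with hC
    have hstep (u t : ℕ) : x • F u t = A u t + B (u + 1) t + C u (t + 1) := by
      have t₁ := triangular_succ ((u : ℤ) - t)
      have t₂ := triangular_succ ((u : ℤ) - t - 1)
      rw [sub_add_cancel] at t₂
      rw [hF, hA, hB, hC, hT, he]
      beta_reduce
      rw [smul_comm x, H.smul_monomial_smul, smul_add, smul_add, smul_smul, smul_smul, smul_smul]
      push_cast
      rw [show (n : ℤ) + 1 - u - t = n - u - t + 1 by ring,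
        show (n : ℤ) + 1 - (u + 1) - t = n - u - t by ring,
        show (n : ℤ) + 1 - u - (t + 1) = n - u - t by ring,
        show (u : ℤ) + 1 - t = u - t + 1 by ring,
        show (u : ℤ) - (t + 1) = u - t - 1 by ring,
        show d - ((u : ℤ) + 1) = d - u - 1 by ring, ← mul_assoc, ← mul_assoc,
        ← zpow_add₀ q_ne_zero, ← zpow_add₀ q_ne_zero]
      congr 1
      · congr 1
        · congr 3
          ring
        · congr 3
          rw [add_sub_cancel_right, t₁]
          ring
      · congr 3
        rw [t₂]
        ring
    have hlhs : qint ((n : ℤ) + 1) • ((dpow qint x (n + 1 : ℕ) * dpow qintDouble w d) • v) =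
        x • ((dpow qint x n * dpow qintDouble w d) • v) := by
      rw [← mul_smul, ← mul_assoc, mul_dpow_qint, smul_mul_assoc, smul_assoc]
      push_cast
      rfl
    have hshiftB (t : ℕ) : ∑ u ∈ Finset.range N, B (u + 1) t = ∑ u ∈ Finset.range N, B u t := by
      refine sum_range_shift (B · t) N ?_ ?_
      · rw [hB]
        rcases Nat.eq_zero_or_pos t with rfl | ht
        · simp
        · rw [hT]
          beta_reduce
          rw [dpow_of_neg qint a (n := ((0 : ℕ) : ℤ) - t) (by omega)]
          simp
      · rw [hB]
        beta_reduce
        rw [hT0 N t (by omega), smul_zero]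
    have hshiftC (u : ℕ) : ∑ t ∈ Finset.range N, C u (t + 1) = ∑ t ∈ Finset.range N, C u t := by
      refine sum_range_shift (C u) N (by simp [hC]) ?_
      rw [hC]
      beta_reduce
      rw [hT0 u N (by omega), smul_zero]
    have hsum : ∑ u ∈ Finset.range N, ∑ t ∈ Finset.range N, x • F u t =
        ∑ u ∈ Finset.range N, ∑ t ∈ Finset.range N, (A u t + B u t + C u t) := by
      simp only [hstep, Finset.sum_add_distrib, hshiftC]
      congr 2
      rw [Finset.sum_comm, Finset.sum_congr rfl fun t _ => hshiftB t, Finset.sum_comm]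
    beta_reduce
    rw [hlhs, ih (by omega), Finset.smul_sum,
      Finset.sum_congr rfl fun u _ => Finset.smul_sum, hsum, Finset.smul_sum]
    refine Finset.sum_congr rfl fun u _ => ?_
    rw [Finset.smul_sum]
    refine Finset.sum_congr rfl fun t _ => ?_
    rw [hA, hB, hC]
    beta_reduce
    rw [← add_smul, ← add_smul, smul_smul]
    push_cast
    congr 1
    have h₁ := zpow_mul_qint_add (e := e u t) (x := (n + 1 - u - t) + (u - t)) (y := 2 * t)
      rfl rfl
    have h₂ := zpow_mul_qint_add (e := e u t - 2 * t) (x := n + 1 - u - t) (y := u - t)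
      (e₁ := e u t - u - t) (e₂ := e u t + (n + 1 - u - t) - 2 * t) (by ring) (by ring)
    rw [show (n : ℤ) + 1 - u - t + (u - t) + 2 * t = n + 1 by ring, h₂,
      show (n : ℤ) + 1 - u - t + (u - t) = n + 1 - 2 * t by ring] at h₁
    rw [← h₁, mul_comm]

end SymmetricRelations

end DividedPowers

/-! ### Segments -/

/-- The generator indexed by `a : ℤ`, that is `f_{2a+1}`. -/
def gen (a : ℤ) : U := RingQuot.mkAlgHom K URel (FreeAlgebra.ι K a)

lemma gen_comm {a b : ℤ} (h : 1 < |a - b|) : Commute (gen a) (gen b) := by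
  have := RingQuot.mkAlgHom_rel K (URel.far a b h)
  rwa [map_mul, map_mul] at this

lemma gen_serre {a b : ℤ} (h : |a - b| = 1) :
    gen a * gen a * gen b + gen b * (gen a * gen a) = (q + q⁻¹) • (gen a * gen b * gen a) := by
  have := RingQuot.mkAlgHom_rel K (URel.serre a b h)
  simp only [map_add, map_mul, map_smul] at this
  exact this

/-- The segment of length `n + 1` starting at the generator `a`. -/
def chain (a : ℤ) : ℕ → U
  | 0 => gen a
  | n + 1 => chain a n * gen (a + n + 1) - q • (gen (a + n + 1) * chain a n)

lemma chain_succ {a b : ℤ} {n : ℕ} (hb : b = a + n + 1) :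
    chain a (n + 1) = chain a n * gen b - q • (gen b * chain a n) := by
  rw [hb, chain]

lemma commute_chain {u : U} {a : ℤ} {n : ℕ}
    (h : ∀ m, a ≤ m → m ≤ a + n → Commute u (gen m)) : Commute u (chain a n) := by
  induction n with
  | zero => exact h a le_rfl (by omega)
  | succ n ih =>
    have h₁ := ih fun m h₁ h₂ => h m h₁ (by omega)
    have h₂ := h (a + n + 1) (by omega) (by omega)
    exact (h₁.mul_right h₂).sub_right ((h₂.mul_right h₁).smul_right q)

lemma commute_gen_chain {a b : ℤ} {n : ℕ} (h : b < a - 1 ∨ a + n + 1 < b) :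
    Commute (gen b) (chain a n) := by
  refine commute_chain fun m h₁ h₂ => gen_comm ?_
  rcases h with h | h
  · rw [abs_of_neg] <;> omega
  · rw [abs_of_pos] <;> omega

section QCommutator

variable {R : Type*} [Ring R] [Algebra K R]

lemma qcomm_assoc {x y z : R} (h : Commute x z) :
    (x * y - q • (y * x)) * z - q • (z * (x * y - q • (y * x))) =
      x * (y * z - q • (z * y)) - q • ((y * z - q • (z * y)) * x) := by
  simp only [sub_mul, mul_sub, smul_mul_assoc, mul_smul_comm, smul_sub, smul_smul, mul_assoc,
    h.eq, h.left_comm]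
  abel

lemma mul_qcomm_of_smul_comm {x y z : R} {r s : K} (h₁ : x * y = r • (y * x))
    (h₂ : x * z = s • (z * x)) :
    x * (y * z - q • (z * y)) = (r * s) • ((y * z - q • (z * y)) * x) := by
  have e₁ : x * (y * z) = (r * s) • (y * z * x) := by
    rw [← mul_assoc, h₁, smul_mul_assoc, mul_assoc, h₂, mul_smul_comm, smul_smul, mul_assoc]
  have e₂ : x * (z * y) = (r * s) • (z * y * x) := by
    rw [← mul_assoc, h₂, smul_mul_assoc, mul_assoc, h₁, mul_smul_comm, smul_smul, mul_assoc,
      mul_comm r]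
  rw [mul_sub, mul_smul_comm, e₁, e₂, sub_mul, smul_mul_assoc, smul_sub, smul_comm q]

lemma qcomm_mul_of_smul_comm {x y z : R} {r s : K} (h₁ : y * x = r • (x * y))
    (h₂ : z * x = s • (x * z)) :
    (y * z - q • (z * y)) * x = (r * s) • (x * (y * z - q • (z * y))) := by
  have e₁ : y * z * x = (r * s) • (x * (y * z)) := by
    rw [mul_assoc, h₂, mul_smul_comm, ← mul_assoc, h₁, smul_mul_assoc, smul_smul, mul_assoc,
      mul_comm r]
  have e₂ : z * y * x = (r * s) • (x * (z * y)) := by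
    rw [mul_assoc, h₁, mul_smul_comm, ← mul_assoc, h₂, smul_mul_assoc, smul_smul, mul_assoc]
  rw [sub_mul, smul_mul_assoc, e₁, e₂, mul_sub, mul_smul_comm, smul_sub, smul_comm q]

lemma qcomm_comm_left {x y : R} (h : x * x * y + y * (x * x) = (q + q⁻¹) • (x * y * x)) :
    x * (x * y - q • (y * x)) = q⁻¹ • ((x * y - q • (y * x)) * x) := by
  rw [← eq_sub_iff_add_eq, mul_assoc] at h
  rw [mul_sub, h, sub_mul, smul_sub, smul_mul_assoc, mul_smul_comm, smul_smul,
    inv_mul_cancel₀ q_ne_zero, one_smul, add_smul]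
  simp only [mul_assoc]
  abel

lemma qcomm_comm_right {x y : R} (h : y * y * x + x * (y * y) = (q + q⁻¹) • (y * x * y)) :
    (x * y - q • (y * x)) * y = q⁻¹ • (y * (x * y - q • (y * x))) := by
  rw [← eq_sub_iff_add_eq'] at h
  rw [sub_mul, mul_assoc, h, mul_sub, smul_sub, smul_mul_assoc, mul_smul_comm, smul_smul,
    inv_mul_cancel₀ q_ne_zero, one_smul, add_smul]
  simp only [mul_assoc]
  abel

/-- The middle generator commutes with a segment of length three. -/
lemma commute_qcomm_qcomm {x y z : R} (hxz : Commute x z)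
    (h₁ : y * y * x + x * (y * y) = (q + q⁻¹) • (y * x * y))
    (h₂ : y * y * z + z * (y * y) = (q + q⁻¹) • (y * z * y)) :
    Commute y ((x * y - q • (y * x)) * z - q • (z * (x * y - q • (y * x)))) := by
  have hr : q + q⁻¹ ≠ 0 := by
    have h := mul_ne_zero (inv_ne_zero q_ne_zero) one_add_q_sq_ne_zero
    rwa [mul_add, mul_one, sq, inv_mul_cancel_left₀ q_ne_zero, add_comm] at h
  have hD : y * ((x * y - q • (y * x)) * z - q • (z * (x * y - q • (y * x)))) -
      ((x * y - q • (y * x)) * z - q • (z * (x * y - q • (y * x)))) * y =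
      y * x * y * z + (q * q) • (y * z * y * x) - x * (y * z * y) - (q * q) • (z * (y * x * y)) -
        q • (y * y * (x * z)) + q • (x * z * (y * y)) := by
    simp only [mul_sub, sub_mul, mul_smul_comm, smul_mul_assoc, mul_assoc, smul_sub, smul_smul,
      hxz.symm.left_comm]
    abel
  have hq : (q + q⁻¹) * q = q * q + 1 := by rw [add_mul, inv_mul_cancel₀ q_ne_zero]
  have e₁ : (q + q⁻¹) • (y * x * y * z) = (y * y * x + x * (y * y)) * z := by
    rw [h₁, smul_mul_assoc]
  have e₂ : (q + q⁻¹) • (y * z * y * x) = (y * y * z + z * (y * y)) * x := by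
    rw [h₂, smul_mul_assoc]
  have e₃ : (q + q⁻¹) • (x * (y * z * y)) = x * (y * y * z + z * (y * y)) := by
    rw [h₂, mul_smul_comm]
  have e₄ : (q + q⁻¹) • (z * (y * x * y)) = z * (y * y * x + x * (y * y)) := by
    rw [h₁, mul_smul_comm]
  rw [commute_iff_eq, ← sub_eq_zero, hD]
  apply smul_right_injective R hr
  simp only [smul_zero, smul_sub, smul_add, smul_comm _ (q * q), e₁, e₂, e₃, e₄]
  simp only [smul_smul, hq, add_smul, one_smul, mul_add, add_mul, smul_add, mul_assoc,
    hxz.symm.eq, hxz.symm.left_comm]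
  abel

variable {M : Type*} [AddCommGroup M] [Module R M] [Module K M] [IsScalarTower K R M]

lemma smul_qcomm_smul_of_commute {x y s t : R} {c : K} {v : M} (hx : x • v = y • v)
    (hs : Commute y s) (ht : Commute x t) (h : c • (s • v) = t • v) :
    c • ((x * s - q • (s * x)) • v) = (t * y - q • (y * t)) • v := by
  have h₁ : (s * x) • v = y • s • v := by rw [mul_smul, hx, ← mul_smul, ← hs.eq, mul_smul]
  have h₂ : (t * y) • v = x • t • v := by rw [mul_smul, ← hx, ← mul_smul, ← ht.eq, mul_smul]
  rw [sub_smul, smul_assoc, h₁, sub_smul, smul_assoc, h₂, mul_smul, mul_smul, ← h, smul_sub,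
    smul_comm c x, smul_comm c q, smul_comm c y]

lemma smul_qcomm_smul_of_smul_comm {x y s t : R} {c : K} {v : M} (hc : c ≠ 0) (hx : x • v = y • v)
    (hs : s * y = c⁻¹ • (y * s)) (ht : t * x = c • (x * t))
    (h : q • (s • v) = c • (t • v)) :
    q • ((s * x - q • (x * s)) • v) = (y * t - q • (t * y)) • v := by
  have h₁ : (s * x) • v = c⁻¹ • y • s • v := by
    rw [mul_smul, hx, ← mul_smul, hs, smul_assoc, mul_smul]
  have h₂ : (t * y) • v = c • x • t • v := by
    rw [mul_smul, ← hx, ← mul_smul, ht, smul_assoc, mul_smul]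
  have h₃ : q • c⁻¹ • y • s • v = y • t • v := by
    rw [smul_comm q, smul_comm q y, h, smul_comm y c, inv_smul_smul₀ hc]
  have h₄ : q • x • s • v = c • x • t • v := by
    rw [smul_comm q x, h, smul_comm x c]
  rw [sub_smul, smul_assoc, h₁, sub_smul, smul_assoc, h₂, mul_smul, mul_smul, smul_sub, h₃, h₄]

end QCommutator

lemma chain_succ' {a b : ℤ} (hb : b = a + 1) (n : ℕ) :
    chain a (n + 1) = gen a * chain b n - q • (chain b n * gen a) := by
  subst hb
  induction n with
  | zero => simp [chain]
  | succ n ih =>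
    rw [chain_succ (a := a) (b := a + n + 2) (by push_cast; ring), ih,
      chain_succ (a := a + 1) (b := a + n + 2) (by ring), qcomm_assoc]
    refine gen_comm ?_
    rw [abs_of_neg] <;> omega

lemma gen_mul_chain (a : ℤ) (n : ℕ) :
    gen a * chain a (n + 1) = q⁻¹ • (chain a (n + 1) * gen a) := by
  induction n with
  | zero =>
    rw [chain_succ rfl]
    exact qcomm_comm_left (gen_serre (by simp))
  | succ n ih =>
    rw [chain_succ rfl]
    have h : Commute (gen a) (gen (a + (n + 1 : ℕ) + 1)) := by
      refine gen_comm ?_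
      rw [abs_of_neg] <;> push_cast <;> omega
    have h' := mul_qcomm_of_smul_comm (s := 1) ih (by rw [one_smul, h.eq])
    rwa [mul_one] at h'

lemma chain_mul_gen {a b : ℤ} {n : ℕ} (hb : b = a + n + 1) :
    chain a (n + 1) * gen b = q⁻¹ • (gen b * chain a (n + 1)) := by
  subst hb
  induction n generalizing a with
  | zero =>
    rw [chain_succ rfl]
    exact qcomm_comm_right (gen_serre (by simp))
  | succ n ih =>
    rw [chain_succ' rfl]
    have := ih (a := a + 1)
    rw [show a + 1 + n + 1 = a + (n + 1 : ℕ) + 1 by push_cast; ring] at this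
    have h : Commute (gen a) (gen (a + (n + 1 : ℕ) + 1)) := by
      refine gen_comm ?_
      rw [abs_of_neg] <;> push_cast <;> omega
    simpa using qcomm_mul_of_smul_comm (r := 1) (by rw [one_smul, h.eq]) this

lemma commute_gen_chain_of_mem {a b : ℤ} {n : ℕ} (h₁ : a < b) (h₂ : b < a + n) :
    Commute (gen b) (chain a n) := by
  induction n generalizing a with
  | zero => omega
  | succ n ih =>
    by_cases hl : b = a + 1
    · subst hl
      clear ih h₁
      induction n with
      | zero => omega
      | succ n ih =>
        rcases Nat.eq_zero_or_pos n with rfl | hn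
        · rw [chain_succ (b := a + 2) (by push_cast; ring), chain_succ (b := a + 1) (by simp)]
          exact commute_qcomm_qcomm (gen_comm (by norm_num)) (gen_serre (by simp))
            (gen_serre (by norm_num))
        · have h := ih (by push_cast; omega)
          have h' : Commute (gen (a + 1)) (gen (a + (n + 1 : ℕ) + 1)) := by
            refine gen_comm ?_
            rw [abs_of_neg] <;> push_cast <;> omega
          exact (h.mul_right h').sub_right ((h'.mul_right h).smul_right q)
    · rw [chain_succ' rfl]
      have h := ih (a := a + 1) (by omega) (by push_cast at h₂; omega)
      have h' : Commute (gen b) (gen a) := by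
        refine gen_comm ?_
        rw [abs_of_pos] <;> omega
      exact (h'.mul_right h).sub_right ((h.mul_right h').smul_right q)

lemma commute_chain_chain {a b : ℤ} {n m : ℕ} (h₁ : a < b) (h₂ : b + m < a + n) :
    Commute (chain a n) (chain b m) :=
  commute_chain fun c h h' => (commute_gen_chain_of_mem (by omega) (by omega)).symm

lemma chain_mul_chain_right {a b : ℤ} (hb : b = a + 1) (n : ℕ) :
    chain a (n + 1) * chain b n = q⁻¹ • (chain b n * chain a (n + 1)) := by
  subst hb
  cases n with
  | zero => exact chain_mul_gen (by simp)
  | succ n =>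
    rw [chain_succ (a := a + 1) rfl]
    have h₁ := chain_mul_gen (a := a) (b := a + 1 + n + 1) (n := n + 1) (by push_cast; ring)
    have h₂ : Commute (chain a (n + 1 + 1)) (chain (a + 1) n) :=
      commute_chain_chain (by omega) (by push_cast; omega)
    simpa using mul_qcomm_of_smul_comm (r := 1) (by rw [one_smul, h₂.eq]) h₁

lemma chain_mul_chain_left (a : ℤ) (n : ℕ) :
    chain a n * chain a (n + 1) = q⁻¹ • (chain a (n + 1) * chain a n) := by
  cases n with
  | zero => exact gen_mul_chain a 0
  | succ n =>
    have h₁ := gen_mul_chain a (n + 1)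
    have h₂ : Commute (chain (a + 1) n) (chain a (n + 1 + 1)) :=
      (commute_chain_chain (by omega) (by push_cast; omega)).symm
    nth_rewrite 1 [chain_succ' rfl]
    nth_rewrite 3 [chain_succ' rfl]
    simpa using qcomm_mul_of_smul_comm (s := 1) h₁ (by rw [one_smul, h₂.eq])

/-! ### Action on the generator `φ̃` -/

lemma fgen_eq_gen {i a : ℤ} (h : i = 2 * a + 1) : fgen i = gen a := by
  rw [fgen, gen, show (i - 1) / 2 = a by omega]

lemma gen_smul_phi {a b : ℤ} (h : a + b = -1) : gen a • phi = gen b • phi := by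
  rw [phi, ← Submodule.Quotient.mk_smul, ← Submodule.Quotient.mk_smul, Submodule.Quotient.eq]
  simp only [smul_eq_mul, mul_one]
  refine Ideal.subset_span ⟨2 * a + 1, odd_two_mul_add_one a, ?_⟩
  rw [fgen_eq_gen rfl, fgen_eq_gen (a := b) (by omega)]

lemma smul_chain_smul_phi (n : ℕ) {a b : ℤ} (ha : a = -n - 2) (hb : b = -n - 1) :
    q • (chain a (2 * n + 2) • phi) = chain b (2 * n + 2) • phi := by
  induction n generalizing a b with
  | zero =>
    obtain rfl : a = -2 := by simpa using ha
    obtain rfl : b = -1 := by simpa using hb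
    have h : (1 : K) • (chain (-2) 1 • phi) = chain 0 1 • phi := by
      rw [chain_succ' (b := -1) (by norm_num), chain_succ (b := 1) (by norm_num)]
      exact smul_qcomm_smul_of_commute (gen_smul_phi (by norm_num)) (gen_comm (by norm_num))
        (gen_comm (by norm_num)) ((one_smul K _).trans (gen_smul_phi (by norm_num)))
    rw [chain_succ (b := 0) (by norm_num), chain_succ' (a := -1) (b := 0) (by norm_num)]
    refine smul_qcomm_smul_of_smul_comm q_ne_zero (gen_smul_phi (by norm_num))
      (chain_mul_gen (by norm_num)) ?_ (congrArg (q • ·) ((one_smul K _).symm.trans h))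
    rw [gen_mul_chain, smul_inv_smul₀ q_ne_zero]
  | succ n ih =>
    push_cast at ha hb
    have h : q • (chain a (2 * n + 3) • phi) = chain (b + 1) (2 * n + 3) • phi := by
      rw [chain_succ' (b := b) (by omega),
        chain_succ (a := b + 1) (b := n + 2) (by push_cast; omega)]
      refine smul_qcomm_smul_of_commute (v := phi) ?_
        (commute_gen_chain (by push_cast; omega)) (commute_gen_chain (by push_cast; omega))
        (ih (by omega) (by omega))
      exact gen_smul_phi (by omega)
    rw [show 2 * (n + 1) + 2 = 2 * n + 3 + 1 by ring,
      chain_succ (b := n + 1) (by push_cast; omega), chain_succ' (a := b) (b := b + 1) rfl]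
    refine smul_qcomm_smul_of_smul_comm (c := 1) (v := phi) one_ne_zero ?_ ?_ ?_
      (h.trans (one_smul K _).symm)
    · exact gen_smul_phi (by omega)
    · rw [inv_one, one_smul]
      exact (commute_gen_chain_of_mem (by omega) (by push_cast; omega)).symm.eq
    · rw [one_smul]
      exact (commute_gen_chain_of_mem (by omega) (by push_cast; omega)).symm.eq

/-! ### Segments in terms of chains -/

lemma segAux_eq_chain {i a : ℤ} (h : i = 2 * a + 1) (n : ℕ) : segAux i n = chain a n := by
  induction n with
  | zero => exact fgen_eq_gen h
  | succ n ih => rw [segAux, chain, ih, fgen_eq_gen (a := a + n + 1) (by rw [h]; ring)]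

lemma seg_eq_chain {i j a : ℤ} {n : ℕ} (hi : i = 2 * a + 1) (hj : j = 2 * (a + n) + 1) :
    seg i j = chain a n := by
  rw [seg, segAux_eq_chain hi, show ((j - i) / 2).toNat = n by omega]

lemma segPow_eq_dpow {i j a : ℤ} {n : ℕ} (hi : i = 2 * a + 1) (hj : j = 2 * (a + n) + 1) (m : ℤ) :
    segPow i j m = dpow qint (chain a n) m := by
  rw [segPow, seg_eq_chain hi hj, dpow, qfact]

lemma segPowM_eq_dpow {i j a : ℤ} {n : ℕ} (hij : i = -j) (hi : i = 2 * a + 1)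
    (hj : j = 2 * (a + n) + 1) (m : ℤ) :
    segPowM i j m = dpow qintDouble (chain a n) m := by
  rw [segPowM, if_pos hij, seg_eq_chain hi hj, dpow]
  rfl

lemma symmetricRelations_chain (p : ℕ) :
    SymmetricRelations (chain (-p - 2) 0) (chain (p + 1) 0) (chain (-p - 1) (2 * p + 2))
      (chain (-p - 2) (2 * p + 3)) (chain (-p - 1) (2 * p + 1)) (chain (-p - 2) (2 * p + 2))
      phi where
  xy := gen_comm (by rw [abs_of_neg] <;> omega)
  xa := by
    rw [chain_succ' (a := -p - 2) (b := -p - 1) (by ring)]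
    exact (add_sub_cancel _ _).symm
  xb := gen_mul_chain _ _
  ba := chain_mul_chain_right (by ring) _
  bY := chain_mul_gen (by push_cast; ring)
  ay := chain_mul_gen (by push_cast; ring)
  xw := by
    rw [chain_succ' (a := -p - 2) (b := -p - 1) (by ring)]
    exact (add_sub_cancel _ _).symm
  cw := chain_mul_chain_right (by ring) _
  wy := by
    rw [chain_succ (a := -p - 1) (b := p + 1) (n := 2 * p + 1) (by push_cast; ring)]
    exact (add_sub_cancel _ _).symm
  wa := chain_mul_chain_left _ _
  xv := gen_smul_phi (by ring)
  cv := smul_chain_smul_phi p rfl rfl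

/-- Proposition 3.20 of Enomoto–Kashiwara. -/
theorem divided_power_straightening :
    (∀ a m : ℕ,
      (segPow (-1) (-1) a * segPowM (-1) 1 m) • phi =
        ∑ s ∈ Finset.range (a / 2 + 1),
          ((∏ ν ∈ Finset.range s, qint (2 * m + 2 * (ν + 1)) / qint (2 * (ν + 1))) *
            q ^ (-2 * ((a : ℤ) - s) * m + ((a : ℤ) - 2 * s) * ((a : ℤ) - 2 * s - 1) / 2)) •
          ((segPow 1 1 ((a : ℤ) - 2 * s) * segPowM (-1) 1 ((m : ℤ) + s)) • phi)) ∧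
    (∀ k : ℤ, Odd k → 1 < k → ∀ n a : ℕ,
      (segPow (-k) (-k) n * segPowM (-k + 2) (k - 2) a) • phi =
        ∑ u ∈ Finset.range (n + 1), ∑ t ∈ Finset.range (u + 1),
          if u + t ≤ n then
            (q ^ (2 * (a : ℤ) * ((n : ℤ) - u - t) + ((u : ℤ) - t) * (((u : ℤ) - t) - 1) / 2
                - ((n : ℤ) - u - t) * ((t : ℤ) + u))) •
            ((segPow k k ((n : ℤ) - u - t) * segPow (-k + 2) k ((u : ℤ) - t) *
              segPowM (-k) k t * segPowM (-k + 2) (k - 2) ((a : ℤ) - u)) • phi)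
          else 0) ∧
    (∀ k l : ℤ, Odd k → Odd l → k < l → ∀ n a : ℕ,
      segPow k k n * segPow (k + 2) l a =
        ∑ s ∈ Finset.range (n + 1),
          q ^ (((n : ℤ) - s) * ((a : ℤ) - s)) •
            (segPow (k + 2) l ((a : ℤ) - s) * segPow k l s * segPow k k ((n : ℤ) - s))) := by
  refine ⟨fun a m => ?_, fun k hk hk1 n a => ?_, fun k l hk hl hkl n a => ?_⟩
  · have hz : ∀ p, segPowM (-1) 1 p = dpow qintDouble (chain (-1) 1) p :=
      segPowM_eq_dpow rfl (by norm_num) (by norm_num)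
    have hx : ∀ p, segPow (-1) (-1) p = dpow qint (chain (-1) 0) p :=
      segPow_eq_dpow (by norm_num) (by norm_num)
    have hy : ∀ p, segPow 1 1 p = dpow qint (chain 0 0) p :=
      segPow_eq_dpow (by norm_num) (by norm_num)
    simp only [hz, hx, hy]
    rw [dpow_mul_dpow_smul (N := a + 1) (x := chain (-1) 0) (y := chain 0 0) (z := chain (-1) 1)
      (by rw [chain_succ' (b := 0) (by norm_num)]; simp [chain]) (chain_mul_chain_left (-1) 0)
      (chain_mul_chain_right (by norm_num) 0) (gen_smul_phi (by norm_num)) m a (by omega)]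
    refine (Finset.sum_subset (Finset.range_mono (by omega)) fun s _ hs => ?_).symm
    rw [Finset.mem_range] at hs
    rw [dpow_of_neg qint _ (by omega), zero_mul, zero_smul, smul_zero]
  · obtain ⟨p, rfl⟩ : ∃ p : ℕ, k = 2 * p + 3 := by
      obtain ⟨c, rfl⟩ := hk
      exact ⟨(c - 1).toNat, by omega⟩
    have hx : ∀ m, segPow (-(2 * (p : ℤ) + 3)) (-(2 * p + 3)) m = dpow qint (chain (-p - 2) 0) m :=
      segPow_eq_dpow (by ring) (by push_cast; ring)
    have hy : ∀ m, segPow (2 * (p : ℤ) + 3) (2 * p + 3) m = dpow qint (chain (p + 1) 0) m :=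
      segPow_eq_dpow (by ring) (by push_cast; ring)
    have ha : ∀ m, segPow (-(2 * (p : ℤ) + 3) + 2) (2 * p + 3) m =
        dpow qint (chain (-p - 1) (2 * p + 2)) m :=
      segPow_eq_dpow (by ring) (by push_cast; ring)
    have hb : ∀ m, segPowM (-(2 * (p : ℤ) + 3)) (2 * p + 3) m =
        dpow qintDouble (chain (-p - 2) (2 * p + 3)) m :=
      segPowM_eq_dpow rfl (by ring) (by push_cast; ring)
    have hw : ∀ m, segPowM (-(2 * (p : ℤ) + 3) + 2) (2 * p + 3 - 2) m =
        dpow qintDouble (chain (-p - 1) (2 * p + 1)) m :=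
      segPowM_eq_dpow (by ring) (by ring) (by push_cast; ring)
    simp only [hx, hy, ha, hb, hw]
    rw [(symmetricRelations_chain p).dpow_mul_dpow_smul a (n + 1) n (by omega)]
    refine Finset.sum_congr rfl fun u hu => ?_
    rw [Finset.mem_range] at hu
    have hsub : Finset.range (u + 1) ⊆ Finset.range (n + 1) := Finset.range_mono (by omega)
    rw [← Finset.sum_subset hsub fun t _ ht => ?_]
    · refine Finset.sum_congr rfl fun t _ => ?_
      split_ifs with h
      · rfl
      · rw [dpow_of_neg qint (chain (p + 1) 0) (by omega)]
        simp only [zero_mul, zero_smul, smul_zero]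
    · rw [Finset.mem_range] at ht
      rw [dpow_of_neg qint (chain (-p - 1) (2 * p + 2)) (by omega)]
      simp only [mul_zero, zero_mul, zero_smul, smul_zero]
  · obtain ⟨c, rfl⟩ := hk
    obtain ⟨d, rfl⟩ := hl
    obtain ⟨p, rfl⟩ : ∃ p : ℕ, d = c + 1 + p := ⟨(d - c - 1).toNat, by omega⟩
    have hx : ∀ m, segPow (2 * c + 1) (2 * c + 1) m = dpow qint (chain c 0) m :=
      segPow_eq_dpow rfl (by simp)
    have hy : ∀ m, segPow (2 * c + 1 + 2) (2 * (c + 1 + p) + 1) m =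
        dpow qint (chain (c + 1) p) m :=
      segPow_eq_dpow (by ring) rfl
    have hz : ∀ m, segPow (2 * c + 1) (2 * (c + 1 + p) + 1) m = dpow qint (chain c (p + 1)) m :=
      segPow_eq_dpow rfl (by push_cast; ring)
    simp only [hx, hy, hz]
    exact dpow_mul_dpow_of_qcomm (by rw [chain_succ' rfl, add_sub_cancel])
      (gen_mul_chain c p) (chain_mul_chain_right rfl p) a (n + 1) n (by omega)

end
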